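/- arXiv:1303.0969 — 2 statements merged into one kernel-verified Lean document; each statement's English description precedes it below -/
import Mathlib

section
/- Let α, ρ ∈ (0,1) with α = [0; a_1, a_2, …] irrational and a_1 ≥ 2 (equivalently α < 1/2), and let u = u_{α,ρ}. Suppose ρ ∉ (α, 1−α), and let k ≥ 0 and 1 ≤ s ≤ a_{k+1} be the lexicographically minimal pair (k,s) such that min{ρ, 1−ρ} ≥ δ_{k,s}. Then the cardinality of APR_u equals 2 + a_1 + ⋯ + a_k + s. -/
open Set

noncomputable section

/-- Exchange of two intervals with parameter `α`, acting on `[0,1)`: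
`T_α(x) = x + 1 - α` for `x ∈ [0,α)` and `T_α(x) = x - α` for `x ∈ [α,1)`. -/
def twoIE (α x : ℝ) : ℝ := if x < α then x + 1 - α else x - α

/-- The Sturmian word with slope `α` and intercept `ρ`:
`false` codes the letter 0 (i.e. `T_α^n(ρ) ∈ [0,α)`), `true` codes the letter 1. -/
def sturmian (α ρ : ℝ) (n : ℕ) : Bool := if α ≤ (twoIE α)^[n] ρ then true else false

/-- The factor of length `n` of an infinite word `u` starting at position `i`. -/
def seg (u : ℕ → Bool) (i n : ℕ) : List Bool := (List.range n).map (fun j => u (i + j))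

/-- The prefix of length `n` of `u`. -/
def wordPrefix (u : ℕ → Bool) (n : ℕ) : List Bool := seg u 0 n

/-- Return time of `x` to the set `I` under `twoIE α`:
the least `m ≥ 1` such that `T_α^m(x) ∈ I`. -/
def returnTime (α : ℝ) (I : Set ℝ) (x : ℝ) : ℕ :=
  sInf {m : ℕ | 0 < m ∧ (twoIE α)^[m] x ∈ I}

/-- The `I`-itinerary of `x`: the prefix of length `returnTime α I x` of the
Sturmian word with slope `α` and intercept `x`. -/
def itin (α : ℝ) (I : Set ℝ) (x : ℝ) : List Bool :=
  wordPrefix (sturmian α x) (returnTime α I x)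

/-- Two binary words are abelian equivalent if they have the same length and the
same number of occurrences of the letter 0 (coded by `false`). -/
def AbEquiv (w w' : List Bool) : Prop :=
  w.length = w'.length ∧ w.count false = w'.count false

/-- `w` is a factor of the infinite word `u`. -/
def IsFactor (u : ℕ → Bool) (w : List Bool) : Prop := ∃ i, seg u i w.length = w

/-- Positions of occurrences in `u` of factors abelian equivalent to `w`. -/
def abOcc (u : ℕ → Bool) (w : List Bool) : Set ℕ :=
  {i | AbEquiv (seg u i w.length) w}

/-- The set of abelian return words to `w` in `u`: the words of `u` lying between
two consecutive occurrences of factors abelian equivalent to `w`. -/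
def AR (u : ℕ → Bool) (w : List Bool) : Set (List Bool) :=
  {v | ∃ i j : ℕ, i ∈ abOcc u w ∧ j ∈ abOcc u w ∧ i < j ∧
        (∀ m, i < m → m < j → m ∉ abOcc u w) ∧ v = seg u i (j - i)}

/-- The set of abelian return words to all nonempty prefixes of `u`. -/
def APR (u : ℕ → Bool) : Set (List Bool) :=
  ⋃ n ∈ {n : ℕ | 1 ≤ n}, AR u (wordPrefix u n)

/-- `S_β`: the set of `[0,β)`-itineraries under `twoIE α`. -/
def Sitin (α β : ℝ) : Set (List Bool) :=
  {w | ∃ x ∈ Ico (0:ℝ) β, itin α (Ico (0:ℝ) β) x = w}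

/-- `R^α_ρ`: the union of the sets of `[0,β)`-itineraries over `ρ ≤ β < 1`. -/
def Rlight (α ρ : ℝ) : Set (List Bool) := ⋃ β ∈ Ico ρ 1, Sitin α β

/-- `R'^α_ρ`: the union of the sets of `[γ,1)`-itineraries over `0 < γ ≤ ρ`. -/
def Rheavy (α ρ : ℝ) : Set (List Bool) :=
  ⋃ γ ∈ Ioc (0:ℝ) ρ, {w | ∃ x ∈ Ico γ 1, itin α (Ico γ 1) x = w}

/-- The Gauss map `x ↦ {1/x}`. -/
def gaussMap (x : ℝ) : ℝ := Int.fract x⁻¹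

/-- The `k`-th partial quotient `a_k` (for `k ≥ 1`) of the continued fraction
expansion `α = [0; a_1, a_2, …]` of `α ∈ (0,1)`. -/
def cfa (α : ℝ) (k : ℕ) : ℕ := ⌊(gaussMap^[k - 1] α)⁻¹⌋₊

/-- `cfPQ α n = (p_{n-1}, q_{n-1})`, numerators and denominators of the convergents
of `α`: `p_{-1} = 1`, `q_{-1} = 0`, `p_0 = 0`, `q_0 = 1`,
`p_k = a_k p_{k-1} + p_{k-2}`, `q_k = a_k q_{k-1} + q_{k-2}`. -/
def cfPQ (α : ℝ) : ℕ → ℤ × ℤ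
  | 0 => (1, 0)
  | 1 => (0, 1)
  | (k + 2) => ((cfa α (k + 1) : ℤ) * (cfPQ α (k + 1)).1 + (cfPQ α k).1,
                (cfa α (k + 1) : ℤ) * (cfPQ α (k + 1)).2 + (cfPQ α k).2)

/-- `δ_{k,s} = |(s-1)(p_k - α q_k) + p_{k-1} - α q_{k-1}|` for `k ≥ 0`, `1 ≤ s ≤ a_{k+1}`. -/
def cfDelta (α : ℝ) (k s : ℕ) : ℝ :=
  |((s : ℝ) - 1) * (((cfPQ α (k + 1)).1 : ℝ) - α * ((cfPQ α (k + 1)).2 : ℝ)) +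
      (((cfPQ α k).1 : ℝ) - α * ((cfPQ α k).2 : ℝ))|

end

section Orbit

variable {α : ℝ}

theorem twoIE_mem_Ico (hα : α ∈ Ioo (0 : ℝ) 1) {x : ℝ} (hx : x ∈ Ico (0 : ℝ) 1) :
    twoIE α x ∈ Ico (0 : ℝ) 1 := by
  obtain ⟨h0, h1⟩ := hα
  obtain ⟨hx0, hx1⟩ := hx
  unfold twoIE
  split_ifs with h <;> constructor <;> linarith

theorem iterate_twoIE_mem_Ico (hα : α ∈ Ioo (0 : ℝ) 1) {x : ℝ} (hx : x ∈ Ico (0 : ℝ) 1) (j : ℕ) :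
    (twoIE α)^[j] x ∈ Ico (0 : ℝ) 1 := by
  induction j with
  | zero => simpa using hx
  | succ j ih =>
    rw [Function.iterate_succ_apply']
    exact twoIE_mem_Ico hα ih

theorem exists_iterate_twoIE_eq (α x : ℝ) (j : ℕ) :
    ∃ z : ℤ, (twoIE α)^[j] x = x - j * α + z := by
  induction j with
  | zero => exact ⟨0, by simp⟩
  | succ j ih =>
    obtain ⟨z, hz⟩ := ih
    rw [Function.iterate_succ_apply', twoIE]
    split_ifs
    · exact ⟨z + 1, by rw [hz]; push_cast; ring⟩
    · exact ⟨z, by rw [hz]; push_cast; ring⟩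

theorem eq_of_mem_Ico_of_sub_eq_intCast {s t : ℝ} (hs : s ∈ Ico (0 : ℝ) 1)
    (ht : t ∈ Ico (0 : ℝ) 1) {z : ℤ} (h : s - t = z) : s = t := by
  have h1 : (-1 : ℝ) < z := by rw [← h]; linarith [hs.1, ht.2]
  have h2 : (z : ℝ) < 1 := by rw [← h]; linarith [hs.2, ht.1]
  have h3 : -1 < z := by exact_mod_cast h1
  have h4 : z < 1 := by exact_mod_cast h2
  have : z = 0 := by omega
  subst this
  simp only [Int.cast_zero] at h
  linarith

theorem iterate_twoIE_eq (hα : α ∈ Ioo (0 : ℝ) 1) {x t : ℝ} (hx : x ∈ Ico (0 : ℝ) 1)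
    (ht : t ∈ Ico (0 : ℝ) 1) {j : ℕ} {z : ℤ} (h : t = x - j * α + z) :
    (twoIE α)^[j] x = t := by
  obtain ⟨z', hz'⟩ := exists_iterate_twoIE_eq α x j
  refine eq_of_mem_Ico_of_sub_eq_intCast (iterate_twoIE_mem_Ico hα hx j) ht (z := z' - z) ?_
  rw [hz', h]
  push_cast
  ring

/-- The letter at position `j` is 1 exactly when the orbit moves to the left at time `j`. -/
theorem sturmian_eq_decide (hα : α ∈ Ioo (0 : ℝ) 1) (x : ℝ) (j : ℕ) :
    sturmian α x j = decide ((twoIE α)^[j + 1] x < (twoIE α)^[j] x) := by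
  have h0 := hα.1
  have h1 := hα.2
  rw [Function.iterate_succ_apply', sturmian, twoIE]
  by_cases h : (twoIE α)^[j] x < α
  · simp [h, not_le.2 h]
    linarith
  · simp [h, not_lt.1 h, h0]

theorem sturmian_iterate (α x : ℝ) (i j : ℕ) :
    sturmian α ((twoIE α)^[i] x) j = sturmian α x (i + j) := by
  simp only [sturmian, ← Function.iterate_add_apply, add_comm i j]

theorem length_seg (u : ℕ → Bool) (i n : ℕ) : (seg u i n).length = n := by simp [seg]

theorem seg_ext {u v : ℕ → Bool} {i k n : ℕ} (h : ∀ j < n, u (i + j) = v (k + j)) :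
    seg u i n = seg v k n := by
  simpa [seg] using h

theorem count_false_seg_sturmian (α x : ℝ) (i n : ℕ) :
    ((seg (sturmian α x) i n).count false : ℝ) =
      (twoIE α)^[i + n] x - (twoIE α)^[i] x + n * α := by
  induction n with
  | zero => simp [seg]
  | succ n ih =>
    have h : seg (sturmian α x) i (n + 1) = seg (sturmian α x) i n ++ [sturmian α x (i + n)] := by
      simp [seg, List.range_succ]
    rw [h, List.count_append, ← add_assoc, Function.iterate_succ_apply']
    push_cast
    rw [ih, sturmian, twoIE]
    by_cases h : (twoIE α)^[i + n] x < α
    · simp [h, not_le.2 h]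
      ring
    · simp [h, not_lt.1 h]
      ring

theorem iterate_twoIE_sub_self (hα : α ∈ Ioo (0 : ℝ) 1) {x : ℝ} (hx : x ∈ Ico (0 : ℝ) 1) (n : ℕ) :
    (twoIE α)^[n] x - x =
      if x < Int.fract (n * α) then 1 - Int.fract (n * α) else -Int.fract (n * α) := by
  have h0 := Int.fract_nonneg ((n : ℝ) * α)
  have h1 := Int.fract_lt_one ((n : ℝ) * α)
  obtain ⟨hx0, hx1⟩ := hx
  have hf := Int.self_sub_floor ((n : ℝ) * α)
  split_ifs with h
  · rw [iterate_twoIE_eq (t := x + 1 - Int.fract ((n : ℝ) * α)) hα ⟨hx0, hx1⟩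
      ⟨by linarith, by linarith⟩ (z := 1 + ⌊(n : ℝ) * α⌋) (by push_cast; linarith)]
    ring
  · rw [iterate_twoIE_eq (t := x - Int.fract ((n : ℝ) * α)) hα ⟨hx0, hx1⟩
      ⟨by linarith, by linarith⟩ (z := ⌊(n : ℝ) * α⌋) (by linarith)]
    ring

theorem mem_abOcc_wordPrefix_iff (hα : α ∈ Ioo (0 : ℝ) 1) {ρ : ℝ} (hρ : ρ ∈ Ico (0 : ℝ) 1)
    (n i : ℕ) :
    i ∈ abOcc (sturmian α ρ) (wordPrefix (sturmian α ρ) n) ↔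
      ((twoIE α)^[i] ρ < Int.fract (n * α) ↔ ρ < Int.fract (n * α)) := by
  have hi := iterate_twoIE_sub_self hα (iterate_twoIE_mem_Ico hα hρ i) n
  have hr := iterate_twoIE_sub_self hα hρ n
  have key : i ∈ abOcc (sturmian α ρ) (wordPrefix (sturmian α ρ) n) ↔
      (twoIE α)^[n] ((twoIE α)^[i] ρ) - (twoIE α)^[i] ρ = (twoIE α)^[n] ρ - ρ := by
    simp only [abOcc, AbEquiv, wordPrefix, mem_ofPred_eq, length_seg, true_and]
    rw [← @Nat.cast_inj ℝ, count_false_seg_sturmian, count_false_seg_sturmian, add_comm i n,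
      Function.iterate_add_apply]
    simp
  rw [key, hi, hr]
  split_ifs with h1 h2 h2 <;> simp [h1, h2]; linarith

theorem exists_nat_mul_add_intCast_mem_Ioo (hirr : Irrational α) (ρ : ℝ) {A B : ℝ} (hAB : A < B) :
    ∃ (n : ℕ) (z : ℤ), 1 ≤ n ∧ ρ + n * α + z ∈ Ioo A B := by
  have hd : DenseRange (· • (α : AddCircle (1 : ℝ)) : ℕ → AddCircle (1 : ℝ)) :=
    denseRange_zsmul_iff_nsmul.1 (AddCircle.denseRange_zsmul_coe_iff.2 (by simpa using hirr))
  have ho : IsOpen ((QuotientAddGroup.mk : ℝ → AddCircle (1 : ℝ)) '' Ioo (A - ρ - α) (B - ρ - α)) :=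
    QuotientAddGroup.isOpenMap_coe _ isOpen_Ioo
  obtain ⟨n, y, hy, hn⟩ := hd.exists_mem_open ho
    ((nonempty_Ioo.2 (by linarith)).image _)
  have hn' : ((y : ℝ) : AddCircle (1 : ℝ)) = ((n * α : ℝ) : AddCircle (1 : ℝ)) := by
    simpa using hn
  rw [QuotientAddGroup.eq, AddSubgroup.mem_zmultiples_iff] at hn'
  obtain ⟨z, hz⟩ := hn'
  simp only [mul_one, zsmul_eq_mul] at hz
  refine ⟨n + 1, -z, by omega, ?_⟩
  have : ρ + ((n + 1 : ℕ) : ℝ) * α + ((-z : ℤ) : ℝ) = y + ρ + α := by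
    push_cast
    linarith
  rw [this]
  exact ⟨by linarith [hy.1], by linarith [hy.2]⟩

theorem exists_fract_nat_mul_mem_Ioo (hirr : Irrational α) {A B : ℝ} (hA : 0 ≤ A) (hB : B ≤ 1)
    (hAB : A < B) : ∃ n : ℕ, 1 ≤ n ∧ Int.fract (n * α) ∈ Ioo A B := by
  obtain ⟨n, z, hn, h⟩ := exists_nat_mul_add_intCast_mem_Ioo hirr 0 hAB
  refine ⟨n, hn, ?_⟩
  rwa [(Int.fract_eq_iff (b := 0 + n * α + z)).2
    ⟨by linarith [h.1], by linarith [h.2], -z, by push_cast; ring⟩]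

/-- Every orbit comes close to any given orbit segment, from the right. -/
theorem exists_shift_iterate_twoIE (hα : α ∈ Ioo (0 : ℝ) 1) (hirr : Irrational α) {ρ x : ℝ}
    (hρ : ρ ∈ Ico (0 : ℝ) 1) (hx : x ∈ Ico (0 : ℝ) 1) (m : ℕ) {c : ℝ} (hc : 0 < c) :
    ∃ (i : ℕ) (d : ℝ), 0 < d ∧ d < c ∧ ∀ j ≤ m, (twoIE α)^[i + j] ρ = (twoIE α)^[j] x + d := by
  obtain ⟨e, he0, he⟩ := Order.exists_between_finsets {0}
    (insert c ((Finset.range (m + 1)).image fun j => 1 - (twoIE α)^[j] x)) (by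
      simp only [Finset.mem_singleton, Finset.mem_insert, Finset.mem_image, Finset.mem_range]
      rintro _ rfl y (rfl | ⟨j, -, rfl⟩)
      · exact hc
      · linarith [(iterate_twoIE_mem_Ico hα hx j).2])
  simp only [Finset.mem_singleton, forall_eq, Finset.mem_insert, Finset.mem_image,
    Finset.mem_range, forall_eq_or_imp, forall_exists_index, and_imp,
    forall_apply_eq_imp_iff₂] at he0 he
  obtain ⟨hec, hej⟩ := he
  obtain ⟨i, z, -, hi⟩ := exists_nat_mul_add_intCast_mem_Ioo hirr.neg ρ
    (show x < x + e by linarith)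
  refine ⟨i, ρ + i * -α + z - x, by linarith [hi.1], by linarith [hi.2], fun j hj => ?_⟩
  obtain ⟨w, hw⟩ := exists_iterate_twoIE_eq α x j
  have hm := iterate_twoIE_mem_Ico hα hx j
  refine iterate_twoIE_eq hα hρ ⟨by linarith [hm.1, hi.1], ?_⟩ (z := z + w) ?_
  · linarith [hej j (by omega), hi.2]
  · rw [hw]
    push_cast
    ring

end Orbit

/-- The first `m - 1` iterates of `x` lie above `x`, above the `m`-th one, and in `[ρ, 1)`, so that
`m` is the return time of `x` to `[0, β)` for some `β ≥ ρ`. -/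
def IsLightReturn (α ρ x : ℝ) (m : ℕ) : Prop :=
  ∀ j, 0 < j → j < m →
    x < (twoIE α)^[j] x ∧ (twoIE α)^[m] x < (twoIE α)^[j] x ∧ ρ ≤ (twoIE α)^[j] x

/-- The first `m - 1` iterates of `x` lie below `x`, below the `m`-th one, and in `[0, ρ)`, so that
`m` is the return time of `x` to `[γ, 1)` for some `γ ≤ ρ`. -/
def IsHeavyReturn (α ρ x : ℝ) (m : ℕ) : Prop :=
  ∀ j, 0 < j → j < m →
    (twoIE α)^[j] x < x ∧ (twoIE α)^[j] x < (twoIE α)^[m] x ∧ (twoIE α)^[j] x < ρ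

/-- The words of length at least 2 read along light returns. -/
def lightWords (α ρ : ℝ) : Set (List Bool) :=
  {v | ∃ m, 2 ≤ m ∧ ∃ x ∈ Ico (0 : ℝ) 1, IsLightReturn α ρ x m ∧ v = wordPrefix (sturmian α x) m}

/-- The words of length at least 2 read along heavy returns. -/
def heavyWords (α ρ : ℝ) : Set (List Bool) :=
  {v | ∃ m, 2 ≤ m ∧ ∃ x ∈ Ico (0 : ℝ) 1, IsHeavyReturn α ρ x m ∧ v = wordPrefix (sturmian α x) m}

section AbelianReturns

variable {α ρ : ℝ}

theorem seg_sturmian_eq_of_shift (hα : α ∈ Ioo (0 : ℝ) 1) {x d : ℝ} {i m : ℕ}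
    (h : ∀ j ≤ m, (twoIE α)^[i + j] ρ = (twoIE α)^[j] x + d) :
    seg (sturmian α ρ) i m = wordPrefix (sturmian α x) m := by
  refine seg_ext fun j hj => ?_
  rw [sturmian_eq_decide hα, sturmian_eq_decide hα, add_assoc, h j hj.le, h (j + 1) hj]
  simp

theorem wordPrefix_mem_APR_of_isLightReturn (hα : α ∈ Ioo (0 : ℝ) 1) (hirr : Irrational α)
    (hρ : ρ ∈ Ioo (0 : ℝ) 1) {x : ℝ} (hx : x ∈ Ico (0 : ℝ) 1) {m : ℕ} (hm : 1 ≤ m)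
    (h : IsLightReturn α ρ x m) : wordPrefix (sturmian α x) m ∈ APR (sturmian α ρ) := by
  have hρ' := Ioo_subset_Ico_self hρ
  obtain ⟨i, d, hd, -, hi⟩ := exists_shift_iterate_twoIE hα hirr hρ' hx m one_pos
  have hsep : ∀ y ∈ ({ρ, x + d, (twoIE α)^[m] x + d} : Finset ℝ),
      ∀ z ∈ insert 1 ((Finset.Ioo 0 m).image fun j => (twoIE α)^[j] x + d), y < z := by
    have h0 := iterate_twoIE_mem_Ico hα hρ' (i + 0)
    have h1 := iterate_twoIE_mem_Ico hα hρ' (i + m)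
    rw [hi 0 (by omega), Function.iterate_zero_apply] at h0
    rw [hi m le_rfl] at h1
    simp only [Finset.mem_insert, Finset.mem_singleton, Finset.mem_image, Finset.mem_Ioo]
    rintro y hy z (rfl | ⟨j, ⟨hj0, hj⟩, rfl⟩)
    · rcases hy with rfl | rfl | rfl
      · exact hρ.2
      · exact h0.2
      · exact h1.2
    · obtain ⟨a1, a2, a3⟩ := h j hj0 hj
      rcases hy with rfl | rfl | rfl <;> linarith
  obtain ⟨A, hA1, hA2⟩ := Order.exists_between_finsets _ _ hsep
  obtain ⟨B, hB1, hB2⟩ := Order.exists_between_finsets {A} _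
    fun y hy z hz => (Finset.mem_singleton.1 hy).symm ▸ hA2 z hz
  simp only [Finset.mem_insert, Finset.mem_singleton, Finset.mem_image, Finset.mem_Ioo,
    forall_eq_or_imp, forall_eq, forall_exists_index, and_imp] at hA1 hB1 hB2
  obtain ⟨hA1, hA2, hA3⟩ := hA1
  obtain ⟨hB2, hB3⟩ := hB2
  obtain ⟨n, hn, hθ1, hθ2⟩ := exists_fract_nat_mul_mem_Ioo hirr (hρ.1.trans hA1).le hB2.le hB1
  have hocc : ∀ j ≤ m, i + j ∈ abOcc (sturmian α ρ) (wordPrefix (sturmian α ρ) n) ↔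
      (twoIE α)^[j] x + d < Int.fract (n * α) := fun j hj => by
    rw [mem_abOcc_wordPrefix_iff hα hρ', hi j hj, iff_true_right (hA1.trans hθ1)]
  refine mem_iUnion₂.2 ⟨n, hn, i, i + m, ?_, ?_, by omega, fun k hk1 hk2 => ?_, ?_⟩
  · exact (hocc 0 (by omega)).2 (hA2.trans hθ1)
  · exact (hocc m le_rfl).2 (hA3.trans hθ1)
  · obtain ⟨j, rfl⟩ := Nat.exists_eq_add_of_lt hk1
    rw [add_assoc, hocc (j + 1) (by omega), not_lt]
    exact (hθ2.trans (hB3 _ (j + 1) (by omega) (by omega) rfl)).le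
  · rw [Nat.add_sub_cancel_left, seg_sturmian_eq_of_shift hα hi]

theorem wordPrefix_mem_APR_of_isHeavyReturn (hα : α ∈ Ioo (0 : ℝ) 1) (hirr : Irrational α)
    (hρ : ρ ∈ Ioo (0 : ℝ) 1) {x : ℝ} (hx : x ∈ Ico (0 : ℝ) 1) {m : ℕ} (hm : 1 ≤ m)
    (h : IsHeavyReturn α ρ x m) : wordPrefix (sturmian α x) m ∈ APR (sturmian α ρ) := by
  have hρ' := Ioo_subset_Ico_self hρ
  obtain ⟨c, hc, hcρ⟩ := Order.exists_between_finsets {0}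
    ((Finset.Ioo 0 m).image fun j => ρ - (twoIE α)^[j] x) (by
      simp only [Finset.mem_singleton, Finset.mem_image, Finset.mem_Ioo]
      rintro _ rfl y ⟨j, ⟨hj0, hj⟩, rfl⟩
      linarith [(h j hj0 hj).2.2])
  simp only [Finset.mem_singleton, forall_eq, Finset.mem_image, Finset.mem_Ioo,
    forall_exists_index, and_imp] at hc hcρ
  obtain ⟨i, d, hd, hdc, hi⟩ := exists_shift_iterate_twoIE hα hirr hρ' hx m hc
  have hsep : ∀ y ∈ insert 0 ((Finset.Ioo 0 m).image fun j => (twoIE α)^[j] x + d),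
      ∀ z ∈ ({ρ, x + d, (twoIE α)^[m] x + d} : Finset ℝ), y < z := by
    have h0 := hx.1
    have h1 := (iterate_twoIE_mem_Ico hα hx m).1
    simp only [Finset.mem_insert, Finset.mem_singleton, Finset.mem_image, Finset.mem_Ioo]
    rintro y (rfl | ⟨j, ⟨hj0, hj⟩, rfl⟩) z hz
    · rcases hz with rfl | rfl | rfl
      · exact hρ.1
      · linarith
      · linarith
    · obtain ⟨a1, a2, a3⟩ := h j hj0 hj
      have := hcρ _ j hj0 hj rfl
      rcases hz with rfl | rfl | rfl <;> linarith
  obtain ⟨B, hB1, hB2⟩ := Order.exists_between_finsets _ _ hsep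
  obtain ⟨A, hA1, hA2⟩ := Order.exists_between_finsets _ {B}
    fun y hy z hz => (Finset.mem_singleton.1 hz).symm ▸ hB1 y hy
  simp only [Finset.mem_insert, Finset.mem_singleton, Finset.mem_image, Finset.mem_Ioo,
    forall_eq_or_imp, forall_eq, forall_exists_index, and_imp] at hA1 hA2 hB2
  obtain ⟨hB2, hB3, hB4⟩ := hB2
  obtain ⟨hA1, hA3⟩ := hA1
  obtain ⟨n, hn, hθ1, hθ2⟩ := exists_fract_nat_mul_mem_Ioo hirr hA1.le (hB2.trans hρ.2).le hA2
  have hocc : ∀ j ≤ m, i + j ∈ abOcc (sturmian α ρ) (wordPrefix (sturmian α ρ) n) ↔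
      ¬ (twoIE α)^[j] x + d < Int.fract (n * α) := fun j hj => by
    rw [mem_abOcc_wordPrefix_iff hα hρ', hi j hj,
      iff_false_right (not_lt.2 (hθ2.trans hB2).le)]
  refine mem_iUnion₂.2 ⟨n, hn, i, i + m, ?_, ?_, by omega, fun k hk1 hk2 => ?_, ?_⟩
  · exact (hocc 0 (by omega)).2 (not_lt.2 (hθ2.trans hB3).le)
  · exact (hocc m le_rfl).2 (not_lt.2 (hθ2.trans hB4).le)
  · obtain ⟨j, rfl⟩ := Nat.exists_eq_add_of_lt hk1
    rw [add_assoc, hocc (j + 1) (by omega), not_not]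
    exact (hA3 _ (j + 1) (by omega) (by omega) rfl).trans hθ1
  · rw [Nat.add_sub_cancel_left, seg_sturmian_eq_of_shift hα hi]

theorem wordPrefix_one (u : ℕ → Bool) : wordPrefix u 1 = [u 0] := by
  simp [wordPrefix, seg]

theorem APR_sturmian_eq (hα : α ∈ Ioo (0 : ℝ) 1) (hirr : Irrational α) (hρ : ρ ∈ Ioo (0 : ℝ) 1) :
    APR (sturmian α ρ) = {[false], [true]} ∪ (lightWords α ρ ∪ heavyWords α ρ) := by
  have hρ' := Ioo_subset_Ico_self hρ
  ext v
  constructor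
  · intro hv
    obtain ⟨n, -, i, j, hi, hj, hij, hmid, rfl⟩ := mem_iUnion₂.1 hv
    obtain ⟨m, rfl⟩ := Nat.exists_eq_add_of_lt hij
    rw [mem_abOcc_wordPrefix_iff hα hρ'] at hi hj
    simp only [mem_abOcc_wordPrefix_iff hα hρ'] at hmid
    have hx := iterate_twoIE_mem_Ico hα hρ' i
    have hw : seg (sturmian α ρ) i (i + m + 1 - i) =
        wordPrefix (sturmian α ((twoIE α)^[i] ρ)) (m + 1) := by
      rw [add_assoc, Nat.add_sub_cancel_left]
      exact seg_ext fun j _ => by rw [sturmian_iterate, zero_add]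
    have hit : ∀ j, (twoIE α)^[j] ((twoIE α)^[i] ρ) = (twoIE α)^[i + j] ρ := fun j => by
      rw [add_comm, Function.iterate_add_apply]
    rw [hw]
    rcases Nat.eq_zero_or_pos m with rfl | hm
    · left
      rw [wordPrefix_one]
      cases sturmian α ((twoIE α)^[i] ρ) 0 <;> simp
    right
    by_cases h : ρ < Int.fract (n * α)
    · refine Or.inl ⟨m + 1, by omega, _, hx, fun l hl0 hl => ?_, rfl⟩
      have hl' := hmid (i + l) (by omega) (by omega)
      simp only [iff_true_right h, not_lt] at hi hj hl'
      rw [hit, hit]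
      exact ⟨by linarith, by rw [← add_assoc]; linarith, by linarith⟩
    · refine Or.inr ⟨m + 1, by omega, _, hx, fun l hl0 hl => ?_, rfl⟩
      have hl' := hmid (i + l) (by omega) (by omega)
      simp only [iff_false_right h, not_lt, not_le] at hi hj hl' h
      rw [hit, hit]
      exact ⟨by linarith, by rw [← add_assoc]; linarith, by linarith⟩
  · rintro ((rfl | rfl) | ⟨m, hm, x, hx, h, rfl⟩ | ⟨m, hm, x, hx, h, rfl⟩)
    · have := wordPrefix_mem_APR_of_isLightReturn (x := 0) (m := 1) hα hirr hρ (by simp) le_rfl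
        (fun j h1 h2 => by omega)
      simpa [wordPrefix_one, sturmian, not_le.2 hα.1] using this
    · have := wordPrefix_mem_APR_of_isLightReturn (x := α) (m := 1) hα hirr hρ
        (Ioo_subset_Ico_self hα) le_rfl (fun j h1 h2 => by omega)
      simpa [wordPrefix_one, sturmian] using this
    · exact wordPrefix_mem_APR_of_isLightReturn hα hirr hρ hx (by omega) h
    · exact wordPrefix_mem_APR_of_isHeavyReturn hα hirr hρ hx (by omega) h

theorem length_wordPrefix (u : ℕ → Bool) (n : ℕ) : (wordPrefix u n).length = n :=
  length_seg u 0 n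

theorem iterate_sub_self_eq_iterate_sub_self (hα : α ∈ Ioo (0 : ℝ) 1) {x y : ℝ} {j : ℕ}
    (hx : x ∈ Ico (0 : ℝ) 1) (hy : y ∈ Ico (0 : ℝ) 1)
    (h : x < (twoIE α)^[j] x ∧ y < (twoIE α)^[j] y ∨
      (twoIE α)^[j] x < x ∧ (twoIE α)^[j] y < y) :
    (twoIE α)^[j] x - x = (twoIE α)^[j] y - y := by
  rw [iterate_twoIE_sub_self hα hx, iterate_twoIE_sub_self hα hy]
  have hx' := iterate_twoIE_sub_self hα hx j
  have hy' := iterate_twoIE_sub_self hα hy j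
  have h0 := Int.fract_nonneg ((j : ℝ) * α)
  have h1 := Int.fract_lt_one ((j : ℝ) * α)
  split_ifs at hx' hy' ⊢ with h2 h3 h3 <;> first | rfl | (rcases h with h | h <;> linarith [h.1, h.2])

theorem wordPrefix_eq_of_iterate_sub_self_eq (hα : α ∈ Ioo (0 : ℝ) 1) {x y : ℝ} {m : ℕ}
    (h : ∀ j, 0 < j → j < m → (twoIE α)^[j] x - x = (twoIE α)^[j] y - y)
    (hlast : (twoIE α)^[m] x < (twoIE α)^[m - 1] x ↔ (twoIE α)^[m] y < (twoIE α)^[m - 1] y) :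
    wordPrefix (sturmian α x) m = wordPrefix (sturmian α y) m := by
  have h' : ∀ j < m, (twoIE α)^[j] x - x = (twoIE α)^[j] y - y := fun j hj => by
    rcases Nat.eq_zero_or_pos j with rfl | h0
    · simp
    · exact h j h0 hj
  refine seg_ext fun j hj => ?_
  rw [zero_add, sturmian_eq_decide hα, sturmian_eq_decide hα, decide_eq_decide]
  rcases Nat.lt_or_ge (j + 1) m with hj' | hj'
  · have h1 := h' j hj
    have h2 := h' (j + 1) hj'
    constructor <;> intro <;> linarith
  · obtain rfl : m = j + 1 := by omega
    exact hlast

theorem injOn_length_lightWords (hα : α ∈ Ioo (0 : ℝ) 1) :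
    InjOn List.length (lightWords α ρ) := by
  rintro _ ⟨m, hm, x, hx, h, rfl⟩ _ ⟨m', -, y, hy, h', rfl⟩ hmm
  rw [length_wordPrefix, length_wordPrefix] at hmm
  subst hmm
  refine wordPrefix_eq_of_iterate_sub_self_eq hα (fun j h0 h1 => ?_) ?_
  · exact iterate_sub_self_eq_iterate_sub_self hα hx hy (Or.inl ⟨(h j h0 h1).1, (h' j h0 h1).1⟩)
  · exact iff_of_true (h (m - 1) (by omega) (by omega)).2.1 (h' (m - 1) (by omega) (by omega)).2.1

theorem injOn_length_heavyWords (hα : α ∈ Ioo (0 : ℝ) 1) :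
    InjOn List.length (heavyWords α ρ) := by
  rintro _ ⟨m, hm, x, hx, h, rfl⟩ _ ⟨m', -, y, hy, h', rfl⟩ hmm
  rw [length_wordPrefix, length_wordPrefix] at hmm
  subst hmm
  refine wordPrefix_eq_of_iterate_sub_self_eq hα (fun j h0 h1 => ?_) ?_
  · exact iterate_sub_self_eq_iterate_sub_self hα hx hy (Or.inr ⟨(h j h0 h1).1, (h' j h0 h1).1⟩)
  · exact iff_of_false (h (m - 1) (by omega) (by omega)).2.1.not_gt
      (h' (m - 1) (by omega) (by omega)).2.1.not_gt

theorem head?_of_mem_lightWords (hα : α ∈ Ioo (0 : ℝ) 1) {v : List Bool}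
    (hv : v ∈ lightWords α ρ) : v.head? = some false := by
  obtain ⟨m, hm, x, -, h, rfl⟩ := hv
  obtain ⟨k, rfl⟩ := Nat.exists_eq_add_of_le' hm
  have h1 := (h 1 one_pos (by omega)).1
  simp only [wordPrefix, seg, List.range_succ_eq_map, List.map_cons, List.head?_cons,
    sturmian_eq_decide hα, zero_add, Option.some_inj]
  exact decide_eq_false h1.not_gt

theorem head?_of_mem_heavyWords (hα : α ∈ Ioo (0 : ℝ) 1) {v : List Bool}
    (hv : v ∈ heavyWords α ρ) : v.head? = some true := by
  obtain ⟨m, hm, x, -, h, rfl⟩ := hv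
  obtain ⟨k, rfl⟩ := Nat.exists_eq_add_of_le' hm
  have h1 := (h 1 one_pos (by omega)).1
  simp only [wordPrefix, seg, List.range_succ_eq_map, List.map_cons, List.head?_cons,
    sturmian_eq_decide hα, zero_add, Option.some_inj]
  exact decide_eq_true h1

theorem image_length_lightWords : List.length '' lightWords α ρ =
    {m | 2 ≤ m ∧ ∃ x ∈ Ico (0 : ℝ) 1, IsLightReturn α ρ x m} := by
  ext m
  constructor
  · rintro ⟨_, ⟨m, hm, x, hx, h, rfl⟩, rfl⟩
    rw [length_wordPrefix]
    exact ⟨hm, x, hx, h⟩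
  · rintro ⟨hm, x, hx, h⟩
    exact ⟨_, ⟨m, hm, x, hx, h, rfl⟩, length_wordPrefix _ _⟩

theorem image_length_heavyWords : List.length '' heavyWords α ρ =
    {m | 2 ≤ m ∧ ∃ x ∈ Ico (0 : ℝ) 1, IsHeavyReturn α ρ x m} := by
  ext m
  constructor
  · rintro ⟨_, ⟨m, hm, x, hx, h, rfl⟩, rfl⟩
    rw [length_wordPrefix]
    exact ⟨hm, x, hx, h⟩
  · rintro ⟨hm, x, hx, h⟩
    exact ⟨_, ⟨m, hm, x, hx, h, rfl⟩, length_wordPrefix _ _⟩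

theorem ncard_APR_sturmian (hα : α ∈ Ioo (0 : ℝ) 1) (hirr : Irrational α)
    (hρ : ρ ∈ Ioo (0 : ℝ) 1)
    (hL : {m | 2 ≤ m ∧ ∃ x ∈ Ico (0 : ℝ) 1, IsLightReturn α ρ x m}.Finite)
    (hH : {m | 2 ≤ m ∧ ∃ x ∈ Ico (0 : ℝ) 1, IsHeavyReturn α ρ x m}.Finite) :
    (APR (sturmian α ρ)).ncard =
      2 + ({m | 2 ≤ m ∧ ∃ x ∈ Ico (0 : ℝ) 1, IsLightReturn α ρ x m}.ncard +
        {m | 2 ≤ m ∧ ∃ x ∈ Ico (0 : ℝ) 1, IsHeavyReturn α ρ x m}.ncard) := by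
  rw [← image_length_lightWords] at hL ⊢
  rw [← image_length_heavyWords] at hH ⊢
  have hL' := hL.of_finite_image (injOn_length_lightWords hα)
  have hH' := hH.of_finite_image (injOn_length_heavyWords hα)
  rw [APR_sturmian_eq hα hirr hρ, (injOn_length_lightWords hα).ncard_image,
    (injOn_length_heavyWords hα).ncard_image, ncard_union_eq ?_ (by simp)
      (hL'.union hH'), ncard_union_eq ?_ hL' hH', ncard_pair (by simp)]
  · refine disjoint_left.2 fun v h1 h2 => ?_
    have := (head?_of_mem_lightWords hα h1).symm.trans (head?_of_mem_heavyWords hα h2)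
    simp at this
  · refine disjoint_left.2 fun v h1 h2 => ?_
    have hv : v.length = 1 := by rcases h1 with rfl | rfl <;> rfl
    rcases h2 with ⟨m, hm, x, -, -, rfl⟩ | ⟨m, hm, x, -, -, rfl⟩ <;>
      · rw [length_wordPrefix] at hv
        omega

end AbelianReturns

/-- Two consecutive fractions `lowNum / lowDen < highNum / highDen` of a Farey subdivision. -/
structure FareyPair where
  lowNum : ℤ
  lowDen : ℕ
  highNum : ℤ
  highDen : ℕ

namespace FareyPair

/-- The distance of `highDen * α` from `highNum`. -/
noncomputable def highGap (α : ℝ) (F : FareyPair) : ℝ := F.highNum - F.highDen * α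

/-- The distance of `lowDen * α` from `lowNum`. -/
noncomputable def lowGap (α : ℝ) (F : FareyPair) : ℝ := F.lowDen * α - F.lowNum

/-- Denominator of the mediant. -/
def den (F : FareyPair) : ℕ := F.lowDen + F.highDen

/-- The Farey pair enclosing `α` after inserting the mediant of `F`. -/
noncomputable def next (α : ℝ) (F : FareyPair) : FareyPair :=
  if F.lowGap α < F.highGap α then ⟨F.lowNum, F.lowDen, F.lowNum + F.highNum, F.den⟩
  else ⟨F.lowNum + F.highNum, F.den, F.highNum, F.highDen⟩

/-- A Farey pair around `α`: adjacent fractions with positive denominators enclosing `α`. -/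
structure Encloses (α : ℝ) (F : FareyPair) : Prop where
  det : F.highNum * F.lowDen - F.lowNum * F.highDen = 1
  lowDen_pos : 0 < F.lowDen
  highDen_pos : 0 < F.highDen
  lowGap_pos : 0 < F.lowGap α
  highGap_pos : 0 < F.highGap α

variable {α : ℝ} {F : FareyPair}

theorem highGap_next_of_lt (h : F.lowGap α < F.highGap α) :
    (F.next α).highGap α = F.highGap α - F.lowGap α := by
  rw [next, if_pos h]
  simp only [highGap, lowGap, den]
  push_cast
  ring

theorem lowGap_next_of_lt (h : F.lowGap α < F.highGap α) :
    (F.next α).lowGap α = F.lowGap α := by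
  rw [next, if_pos h]
  rfl

theorem highGap_next_of_not_lt (h : ¬ F.lowGap α < F.highGap α) :
    (F.next α).highGap α = F.highGap α := by
  rw [next, if_neg h]
  rfl

theorem lowGap_next_of_not_lt (h : ¬ F.lowGap α < F.highGap α) :
    (F.next α).lowGap α = F.lowGap α - F.highGap α := by
  rw [next, if_neg h]
  simp only [highGap, lowGap, den]
  push_cast
  ring

theorem Encloses.lowGap_ne_highGap (hF : F.Encloses α) (hirr : Irrational α) :
    F.lowGap α ≠ F.highGap α := by
  intro h
  have hd : (F.den : ℚ) ≠ 0 := by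
    have := hF.lowDen_pos
    simp only [den]
    positivity
  refine hirr ⟨(F.lowNum + F.highNum : ℤ) / (F.den : ℚ), ?_⟩
  have hd' : (F.den : ℝ) ≠ 0 := by exact_mod_cast hd
  push_cast
  rw [div_eq_iff hd']
  simp only [lowGap, highGap] at h
  simp only [den]
  push_cast
  linarith

theorem Encloses.next (hF : F.Encloses α) (hirr : Irrational α) : (F.next α).Encloses α := by
  have hne := hF.lowGap_ne_highGap hirr
  obtain ⟨hdet, hl, hh, hlg, hhg⟩ := hF
  by_cases h : F.lowGap α < F.highGap α
  · refine ⟨?_, ?_, ?_, by rwa [lowGap_next_of_lt h], by rw [highGap_next_of_lt h]; linarith⟩ <;>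
      rw [FareyPair.next, if_pos h]
    · simp only [den]
      push_cast
      linarith
    · exact hl
    · simp only [den]
      omega
  · have h' : F.highGap α < F.lowGap α := lt_of_le_of_ne (not_lt.1 h) hne.symm
    refine ⟨?_, ?_, ?_, by rw [lowGap_next_of_not_lt h]; linarith,
      by rwa [highGap_next_of_not_lt h]⟩ <;>
      rw [FareyPair.next, if_neg h]
    · simp only [den]
      push_cast
      linarith
    · simp only [den]
      omega
    · exact hh

/-- Multiples of `α` below the mediant's denominator approximate integers at best as well as the
endpoints of the Farey pair. -/
theorem Encloses.gap_le (hF : F.Encloses α) (i : ℤ) {j : ℕ} (hj0 : 0 < j) (hj : j < F.den) :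
    F.highGap α ≤ i - j * α ∨ i - j * α ≤ -F.lowGap α := by
  obtain ⟨hdet, hl, hh, hlg, hhg⟩ := hF
  set c : ℤ := i * F.lowDen - j * F.lowNum with hc
  set d : ℤ := j * F.highNum - i * F.highDen with hd
  have hi : i = c * F.highNum + d * F.lowNum := by
    linear_combination (-i) * hdet
  have hj' : (j : ℤ) = c * F.highDen + d * F.lowDen := by
    linear_combination (-(j : ℤ)) * hdet
  have hv : (i : ℝ) - j * α = c * F.highGap α - d * F.lowGap α := by
    have h1 : (i : ℝ) = c * F.highNum + d * F.lowNum := by exact_mod_cast hi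
    have h2 : (j : ℝ) = c * F.highDen + d * F.lowDen := by exact_mod_cast hj'
    rw [h1, h2, highGap, lowGap]
    ring
  rw [hv]
  have hl' : (0 : ℤ) < F.lowDen := by exact_mod_cast hl
  have hh' : (0 : ℤ) < F.highDen := by exact_mod_cast hh
  have hj0' : (0 : ℤ) < j := by exact_mod_cast hj0
  have hj1' : (j : ℤ) < F.lowDen + F.highDen := by exact_mod_cast hj
  rcases le_or_gt c 0 with hc0 | hc0
  · rcases le_or_gt d 0 with hd0 | hd0
    · nlinarith
    · right
      have h1 : (c : ℝ) ≤ 0 := by exact_mod_cast hc0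
      have h2 : (1 : ℝ) ≤ d := by exact_mod_cast hd0
      nlinarith
  · rcases le_or_gt d 0 with hd0 | hd0
    · left
      have h1 : (d : ℝ) ≤ 0 := by exact_mod_cast hd0
      have h2 : (1 : ℝ) ≤ c := by exact_mod_cast hc0
      nlinarith
    · nlinarith

end FareyPair

/-- The Farey pairs enclosing `α ∈ (0, 1)`, starting from `0 / 1 < 1 / 1`. -/
noncomputable def fareyPair (α : ℝ) : ℕ → FareyPair
  | 0 => ⟨0, 1, 1, 1⟩
  | n + 1 => (fareyPair α n).next α

section Returns

open FareyPair

variable {α ρ : ℝ}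

theorem fareyPair_encloses (hα : α ∈ Ioo (0 : ℝ) 1) (hirr : Irrational α) (n : ℕ) :
    (fareyPair α n).Encloses α := by
  induction n with
  | zero => exact ⟨by simp [fareyPair], by simp [fareyPair], by simp [fareyPair],
      by simpa [fareyPair, lowGap] using hα.1, by simpa [fareyPair, highGap] using hα.2⟩
  | succ n ih => exact ih.next hirr

theorem strictMono_den_fareyPair (hα : α ∈ Ioo (0 : ℝ) 1) (hirr : Irrational α) :
    StrictMono fun n => (fareyPair α n).den := by
  refine strictMono_nat_of_lt_succ fun n => ?_
  have h1 := (fareyPair_encloses hα hirr n).lowDen_pos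
  have h2 := (fareyPair_encloses hα hirr n).highDen_pos
  simp only [fareyPair, next]
  split_ifs <;> simp only [den] <;> omega

theorem antitone_gap_sum_fareyPair (hα : α ∈ Ioo (0 : ℝ) 1) (hirr : Irrational α) :
    Antitone fun n => (fareyPair α n).highGap α + (fareyPair α n).lowGap α := by
  refine antitone_nat_of_succ_le fun n => ?_
  have h1 := (fareyPair_encloses hα hirr n).lowGap_pos
  have h2 := (fareyPair_encloses hα hirr n).highGap_pos
  simp only [fareyPair]
  by_cases h : (fareyPair α n).lowGap α < (fareyPair α n).highGap α
  · rw [highGap_next_of_lt h, lowGap_next_of_lt h]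
    linarith
  · rw [highGap_next_of_not_lt h, lowGap_next_of_not_lt h]
    linarith

theorem exists_den_le_lt (hα : α ∈ Ioo (0 : ℝ) 1) (hirr : Irrational α) {m : ℕ} (hm : 2 ≤ m) :
    ∃ n, (fareyPair α n).den ≤ m ∧ m < (fareyPair α (n + 1)).den := by
  have hmono := strictMono_den_fareyPair hα hirr
  have hex : ∃ n, m < (fareyPair α n).den := ⟨m + 1, (Nat.lt_succ_self m).trans_le (hmono.le_apply)⟩
  classical
  rcases hk : Nat.find hex with _ | n
  · have := Nat.find_spec hex
    rw [hk] at this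
    simp only [fareyPair, den] at this
    omega
  · refine ⟨n, not_lt.1 (Nat.find_min hex (by omega)), ?_⟩
    rw [← hk]
    exact Nat.find_spec hex

theorem gap_sum_le_one (hα : α ∈ Ioo (0 : ℝ) 1) (hirr : Irrational α) (n : ℕ) :
    (fareyPair α n).highGap α + (fareyPair α n).lowGap α ≤ 1 := by
  refine (antitone_gap_sum_fareyPair hα hirr (Nat.zero_le n)).trans ?_
  simp [fareyPair, highGap, lowGap]

theorem FareyPair.Encloses.exists_int_between {F : FareyPair} (hF : F.Encloses α) {j : ℕ}
    (hj0 : 0 < j) (hj : j < F.den) :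
    ∃ z : ℤ, F.highGap α ≤ z - j * α ∧ z - j * α ≤ 1 - F.lowGap α := by
  have h1 := Int.le_ceil ((j : ℝ) * α)
  have h2 := Int.ceil_lt_add_one ((j : ℝ) * α)
  have hl := hF.lowGap_pos
  have hh := hF.highGap_pos
  refine ⟨⌈(j : ℝ) * α⌉, ?_, ?_⟩
  · rcases hF.gap_le ⌈(j : ℝ) * α⌉ hj0 hj with h | h <;> linarith
  · rcases hF.gap_le (⌈(j : ℝ) * α⌉ - 1) hj0 hj with h | h <;> push_cast at h <;> linarith

theorem iterate_twoIE_eq_of_self_lt (hα : α ∈ Ioo (0 : ℝ) 1) {x v : ℝ} (hx : x ∈ Ico (0 : ℝ) 1)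
    {j : ℕ} (h : x < (twoIE α)^[j] x) (hv : v ∈ Ico (0 : ℝ) 1) (z : ℤ) (hz : v = z - j * α) :
    (twoIE α)^[j] x = x + v := by
  obtain ⟨w, hw⟩ := exists_iterate_twoIE_eq α x j
  have h1 := (iterate_twoIE_mem_Ico hα hx j).2
  have := eq_of_mem_Ico_of_sub_eq_intCast (s := (twoIE α)^[j] x - x) (t := v) (z := w - z)
    ⟨by linarith, by linarith [hx.1]⟩ hv (by rw [hw, hz]; push_cast; ring)
  linarith

theorem iterate_twoIE_eq_of_lt_self (hα : α ∈ Ioo (0 : ℝ) 1) {x v : ℝ} (hx : x ∈ Ico (0 : ℝ) 1)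
    {j : ℕ} (h : (twoIE α)^[j] x < x) (hv : v ∈ Ico (0 : ℝ) 1) (z : ℤ) (hz : v = z - j * α) :
    (twoIE α)^[j] x = x + v - 1 := by
  obtain ⟨w, hw⟩ := exists_iterate_twoIE_eq α x j
  have h1 := (iterate_twoIE_mem_Ico hα hx j).1
  have := eq_of_mem_Ico_of_sub_eq_intCast (s := (twoIE α)^[j] x - x + 1) (t := v) (z := w - z + 1)
    ⟨by linarith [hx.2], by linarith⟩ hv (by rw [hw, hz]; push_cast; ring)
  linarith

theorem exists_isLightReturn_iff (hα : α ∈ Ioo (0 : ℝ) 1) (hirr : Irrational α) {m : ℕ}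
    (hm : 2 ≤ m) : (∃ x ∈ Ico (0 : ℝ) 1, IsLightReturn α ρ x m) ↔
      ∃ n, ρ < (fareyPair α n).highGap α + (fareyPair α n).lowGap α ∧
        (fareyPair α n).den = m := by
  constructor
  · rintro ⟨x, hx, h⟩
    obtain ⟨n, hn, hn'⟩ := exists_den_le_lt hα hirr hm
    have hF := fareyPair_encloses hα hirr n
    have hF' := hF.next hirr
    have hsum := gap_sum_le_one hα hirr n
    have hne := hF.lowGap_ne_highGap hirr
    rw [fareyPair] at hn'
    refine ⟨n, ?_⟩
    generalize fareyPair α n = F at *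
    have hl := hF.lowDen_pos
    have hh := hF.highDen_pos
    have hlg := hF.lowGap_pos
    have hhg := hF.highGap_pos
    have hden : F.den = F.lowDen + F.highDen := rfl
    have eh := h F.highDen hh (by omega)
    have el := h F.lowDen hl (by omega)
    have th := iterate_twoIE_eq_of_self_lt hα hx eh.1 (v := F.highGap α)
      ⟨hhg.le, by linarith⟩ F.highNum rfl
    have tl := iterate_twoIE_eq_of_self_lt hα hx el.1 (v := 1 - F.lowGap α)
      ⟨by linarith, by linarith⟩ (F.lowNum + 1) (by simp only [lowGap]; push_cast; ring)
    have hl1 := (iterate_twoIE_mem_Ico hα hx F.lowDen).2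
    refine ⟨by linarith, by_contra fun hnm => ?_⟩
    have ed := h F.den (by omega) (by omega)
    have hd1 := (iterate_twoIE_mem_Ico hα hx F.den).2
    have hm0 := (iterate_twoIE_mem_Ico hα hx m).1
    obtain ⟨z, hz⟩ := exists_iterate_twoIE_eq α x m
    have hgap := hF'.gap_le z (by omega) hn'
    by_cases hlt : F.lowGap α < F.highGap α
    · rw [highGap_next_of_lt hlt, lowGap_next_of_lt hlt] at hgap
      have td := iterate_twoIE_eq_of_self_lt hα hx ed.1 (v := F.highGap α - F.lowGap α)
        ⟨by linarith, by linarith⟩ (F.highNum + F.lowNum)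
        (by simp only [highGap, lowGap, den]; push_cast; ring)
      rcases hgap with hgap | hgap <;> linarith
    · rw [highGap_next_of_not_lt hlt, lowGap_next_of_not_lt hlt] at hgap
      have td := iterate_twoIE_eq_of_self_lt hα hx ed.1 (v := 1 + F.highGap α - F.lowGap α)
        ⟨by linarith, by linarith [lt_of_le_of_ne (not_lt.1 hlt) hne.symm]⟩
        (F.highNum + F.lowNum + 1) (by simp only [highGap, lowGap, den]; push_cast; ring)
      rcases hgap with hgap | hgap <;> linarith
  · rintro ⟨n, hn, rfl⟩
    have hF := fareyPair_encloses hα hirr n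
    have hsum := gap_sum_le_one hα hirr n
    generalize fareyPair α n = F at *
    have hlg := hF.lowGap_pos
    have hhg := hF.highGap_pos
    set x := max (max 0 (F.lowGap α - F.highGap α)) (ρ - F.highGap α) with hx_def
    have hx0 : 0 ≤ x := (le_max_left _ _).trans (le_max_left _ _)
    have hx1 : F.lowGap α - F.highGap α ≤ x := (le_max_right _ _).trans (le_max_left _ _)
    have hx2 : ρ - F.highGap α ≤ x := le_max_right _ _
    have hx3 : x < F.lowGap α := max_lt (max_lt hlg (by linarith)) (by linarith)
    have hx : x ∈ Ico (0 : ℝ) 1 := ⟨hx0, by linarith⟩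
    clear_value x
    refine ⟨x, hx, fun j h0 h1 => ?_⟩
    obtain ⟨z, hz1, hz2⟩ := hF.exists_int_between h0 h1
    rw [iterate_twoIE_eq hα hx (t := x + (z - j * α)) ⟨by linarith, by linarith⟩ (z := z) (by ring),
      iterate_twoIE_eq hα hx (t := x + F.highGap α - F.lowGap α) ⟨by linarith, by linarith⟩
        (z := F.highNum + F.lowNum) (by simp only [highGap, lowGap, den]; push_cast; ring)]
    exact ⟨by linarith, by linarith, by linarith⟩

theorem exists_isHeavyReturn_iff (hα : α ∈ Ioo (0 : ℝ) 1) (hirr : Irrational α) {m : ℕ}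
    (hm : 2 ≤ m) : (∃ x ∈ Ico (0 : ℝ) 1, IsHeavyReturn α ρ x m) ↔
      ∃ n, 1 - ρ < (fareyPair α n).highGap α + (fareyPair α n).lowGap α ∧
        (fareyPair α n).den = m := by
  constructor
  · rintro ⟨x, hx, h⟩
    obtain ⟨n, hn, hn'⟩ := exists_den_le_lt hα hirr hm
    have hF := fareyPair_encloses hα hirr n
    have hF' := hF.next hirr
    have hsum := gap_sum_le_one hα hirr n
    have hne := hF.lowGap_ne_highGap hirr
    rw [fareyPair] at hn'
    refine ⟨n, ?_⟩
    generalize fareyPair α n = F at *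
    have hl := hF.lowDen_pos
    have hh := hF.highDen_pos
    have hlg := hF.lowGap_pos
    have hhg := hF.highGap_pos
    have hden : F.den = F.lowDen + F.highDen := rfl
    have eh := h F.highDen hh (by omega)
    have el := h F.lowDen hl (by omega)
    have th := iterate_twoIE_eq_of_lt_self hα hx eh.1 (v := F.highGap α)
      ⟨hhg.le, by linarith⟩ F.highNum rfl
    have tl := iterate_twoIE_eq_of_lt_self hα hx el.1 (v := 1 - F.lowGap α)
      ⟨by linarith, by linarith⟩ (F.lowNum + 1) (by simp only [lowGap]; push_cast; ring)
    have hh0 := (iterate_twoIE_mem_Ico hα hx F.highDen).1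
    refine ⟨by linarith, by_contra fun hnm => ?_⟩
    have ed := h F.den (by omega) (by omega)
    have hd0 := (iterate_twoIE_mem_Ico hα hx F.den).1
    have hm1 := (iterate_twoIE_mem_Ico hα hx m).2
    obtain ⟨z, hz⟩ := exists_iterate_twoIE_eq α x m
    have hgap := hF'.gap_le z (by omega) hn'
    by_cases hlt : F.lowGap α < F.highGap α
    · rw [highGap_next_of_lt hlt, lowGap_next_of_lt hlt] at hgap
      have td := iterate_twoIE_eq_of_lt_self hα hx ed.1 (v := F.highGap α - F.lowGap α)
        ⟨by linarith, by linarith⟩ (F.highNum + F.lowNum)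
        (by simp only [highGap, lowGap, den]; push_cast; ring)
      rcases hgap with hgap | hgap <;> linarith
    · rw [highGap_next_of_not_lt hlt, lowGap_next_of_not_lt hlt] at hgap
      have td := iterate_twoIE_eq_of_lt_self hα hx ed.1 (v := 1 + F.highGap α - F.lowGap α)
        ⟨by linarith, by linarith [lt_of_le_of_ne (not_lt.1 hlt) hne.symm]⟩
        (F.highNum + F.lowNum + 1) (by simp only [highGap, lowGap, den]; push_cast; ring)
      rcases hgap with hgap | hgap <;> linarith
  · rintro ⟨n, hn, rfl⟩
    have hF := fareyPair_encloses hα hirr n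
    have hsum := gap_sum_le_one hα hirr n
    generalize fareyPair α n = F at *
    have hlg := hF.lowGap_pos
    have hhg := hF.highGap_pos
    have hx : 1 - F.highGap α ∈ Ico (0 : ℝ) 1 := ⟨by linarith, by linarith⟩
    refine ⟨1 - F.highGap α, hx, fun j h0 h1 => ?_⟩
    obtain ⟨z, hz1, hz2⟩ := hF.exists_int_between h0 h1
    rw [iterate_twoIE_eq hα hx (t := 1 - F.highGap α + (z - j * α) - 1)
        ⟨by linarith, by linarith⟩ (z := z - 1) (by push_cast; ring),
      iterate_twoIE_eq hα hx (t := 1 - F.lowGap α) ⟨by linarith, by linarith⟩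
        (z := F.highNum + F.lowNum) (by simp only [highGap, lowGap, den]; push_cast; ring)]
    exact ⟨by linarith, by linarith, by linarith⟩

theorem setOf_den_eq_image (hα : α ∈ Ioo (0 : ℝ) 1) (hirr : Irrational α) (t : ℝ) {N : ℕ}
    (hN : (fareyPair α N).highGap α + (fareyPair α N).lowGap α ≤ t)
    (hlt : ∀ n, n + 1 = N → t < (fareyPair α n).highGap α + (fareyPair α n).lowGap α) :
    {m | ∃ n, t < (fareyPair α n).highGap α + (fareyPair α n).lowGap α ∧
      (fareyPair α n).den = m} = (fun n => (fareyPair α n).den) '' Iio N := by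
  have hanti := antitone_gap_sum_fareyPair hα hirr
  ext m
  refine exists_congr fun n => and_congr_left' ⟨fun h => ?_, fun h => ?_⟩
  · by_contra hn
    exact absurd (h.trans_le ((hanti (not_lt.1 hn)).trans hN)) (lt_irrefl t)
  · obtain ⟨k, rfl⟩ : ∃ k, k + 1 = N := ⟨N - 1, by have : n < N := h; omega⟩
    exact (hlt k rfl).trans_le (hanti (Nat.lt_succ_iff.1 h))

theorem two_le_den (hα : α ∈ Ioo (0 : ℝ) 1) (hirr : Irrational α) (n : ℕ) :
    2 ≤ (fareyPair α n).den := by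
  have h1 := (fareyPair_encloses hα hirr n).lowDen_pos
  have h2 := (fareyPair_encloses hα hirr n).highDen_pos
  simp only [den]
  omega

/-- The abelian return words to prefixes are counted by the two steps of the Farey subdivision at
which the gap sum drops to `ρ`, respectively `1 - ρ`. -/
theorem ncard_APR_sturmian_eq_add (hα : α ∈ Ioo (0 : ℝ) 1) (hirr : Irrational α)
    (hρ : ρ ∈ Ioo (0 : ℝ) 1) {M N : ℕ}
    (hM : (fareyPair α M).highGap α + (fareyPair α M).lowGap α ≤ ρ)
    (hM' : ∀ n, n + 1 = M → ρ < (fareyPair α n).highGap α + (fareyPair α n).lowGap α)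
    (hN : (fareyPair α N).highGap α + (fareyPair α N).lowGap α ≤ 1 - ρ)
    (hN' : ∀ n, n + 1 = N → 1 - ρ < (fareyPair α n).highGap α + (fareyPair α n).lowGap α) :
    (APR (sturmian α ρ)).ncard = 2 + (M + N) := by
  have hinj := (strictMono_den_fareyPair hα hirr).injective
  have hL : {m | 2 ≤ m ∧ ∃ x ∈ Ico (0 : ℝ) 1, IsLightReturn α ρ x m} =
      (fun n => (fareyPair α n).den) '' Iio M := by
    rw [← setOf_den_eq_image hα hirr ρ hM hM']
    ext m
    constructor
    · rintro ⟨hm, h⟩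
      exact (exists_isLightReturn_iff hα hirr hm).1 h
    · rintro ⟨n, h, rfl⟩
      exact ⟨two_le_den hα hirr n,
        (exists_isLightReturn_iff hα hirr (two_le_den hα hirr n)).2 ⟨n, h, rfl⟩⟩
  have hH : {m | 2 ≤ m ∧ ∃ x ∈ Ico (0 : ℝ) 1, IsHeavyReturn α ρ x m} =
      (fun n => (fareyPair α n).den) '' Iio N := by
    rw [← setOf_den_eq_image hα hirr (1 - ρ) hN hN']
    ext m
    constructor
    · rintro ⟨hm, h⟩
      exact (exists_isHeavyReturn_iff hα hirr hm).1 h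
    · rintro ⟨n, h, rfl⟩
      exact ⟨two_le_den hα hirr n,
        (exists_isHeavyReturn_iff hα hirr (two_le_den hα hirr n)).2 ⟨n, h, rfl⟩⟩
  rw [ncard_APR_sturmian hα hirr hρ, hL, hH, ncard_image_of_injective _ hinj,
    ncard_image_of_injective _ hinj, ncard_Iio_nat, ncard_Iio_nat]
  · rw [hL]
    exact (finite_Iio M).image _
  · rw [hH]
    exact (finite_Iio N).image _

end Returns

/-- `cfErr α k = |p_{k-1} - α q_{k-1}|`, with its alternating sign made explicit. -/
noncomputable def cfErr (α : ℝ) (k : ℕ) : ℝ :=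
  (-1) ^ k * (((cfPQ α k).1 : ℝ) - α * ((cfPQ α k).2 : ℝ))

/-- Number of pairs `(i, s)` with `i < k` and `1 ≤ s ≤ a_{i+1}`. -/
noncomputable def cfSum (α : ℝ) (k : ℕ) : ℕ := ∑ i ∈ Finset.range k, cfa α (i + 1)

section ContinuedFraction

open FareyPair

variable {α : ℝ}

theorem irrational_gaussMap {x : ℝ} (hx : Irrational x) : Irrational (gaussMap x) := by
  rw [gaussMap, ← Int.self_sub_floor]
  exact (irrational_inv_iff.2 hx).sub_intCast _

theorem irrational_iterate_gaussMap (hirr : Irrational α) (k : ℕ) :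
    Irrational (gaussMap^[k] α) := by
  induction k with
  | zero => simpa using hirr
  | succ k ih =>
    rw [Function.iterate_succ_apply']
    exact irrational_gaussMap ih

theorem iterate_gaussMap_mem_Ioo (hα : α ∈ Ioo (0 : ℝ) 1) (hirr : Irrational α) (k : ℕ) :
    gaussMap^[k] α ∈ Ioo (0 : ℝ) 1 := by
  have h0 := (irrational_iterate_gaussMap hirr k).ne_zero
  cases k with
  | zero => simpa using hα
  | succ k =>
    rw [Function.iterate_succ_apply', gaussMap] at h0 ⊢
    exact ⟨lt_of_le_of_ne (Int.fract_nonneg _) h0.symm, Int.fract_lt_one _⟩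

theorem cfErr_zero : cfErr α 0 = 1 := by simp [cfErr, cfPQ]

theorem cfErr_one : cfErr α 1 = α := by simp [cfErr, cfPQ]

theorem cfErr_add_two (k : ℕ) :
    cfErr α (k + 2) = cfErr α k - cfa α (k + 1) * cfErr α (k + 1) := by
  simp only [cfErr, cfPQ]
  push_cast
  ring

theorem iterate_gaussMap_succ (hα : α ∈ Ioo (0 : ℝ) 1) (hirr : Irrational α) (k : ℕ) :
    gaussMap^[k + 1] α = (gaussMap^[k] α)⁻¹ - cfa α (k + 1) := by
  have h0 := (iterate_gaussMap_mem_Ioo hα hirr k).1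
  rw [Function.iterate_succ_apply', cfa, Nat.add_sub_cancel, gaussMap, ← Int.self_sub_floor,
    natCast_floor_eq_intCast_floor (inv_nonneg.2 h0.le)]

theorem cfErr_succ (hα : α ∈ Ioo (0 : ℝ) 1) (hirr : Irrational α) (k : ℕ) :
    cfErr α (k + 1) = gaussMap^[k] α * cfErr α k := by
  induction k with
  | zero => simp [cfErr_zero, cfErr_one]
  | succ k ih =>
    have h0 := (iterate_gaussMap_mem_Ioo hα hirr k).1
    rw [cfErr_add_two, iterate_gaussMap_succ hα hirr, ih]
    field_simp

theorem cfErr_pos (hα : α ∈ Ioo (0 : ℝ) 1) (hirr : Irrational α) (k : ℕ) : 0 < cfErr α k := by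
  induction k with
  | zero => simp [cfErr_zero]
  | succ k ih =>
    rw [cfErr_succ hα hirr]
    exact mul_pos (iterate_gaussMap_mem_Ioo hα hirr k).1 ih

theorem cfErr_succ_lt (hα : α ∈ Ioo (0 : ℝ) 1) (hirr : Irrational α) (k : ℕ) :
    cfErr α (k + 1) < cfErr α k := by
  rw [cfErr_succ hα hirr]
  exact mul_lt_of_lt_one_left (cfErr_pos hα hirr k) (iterate_gaussMap_mem_Ioo hα hirr k).2

theorem one_le_cfa (hα : α ∈ Ioo (0 : ℝ) 1) (hirr : Irrational α) (k : ℕ) :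
    1 ≤ cfa α (k + 1) := by
  have h := iterate_gaussMap_mem_Ioo hα hirr k
  rw [cfa, Nat.add_sub_cancel, Nat.one_le_floor_iff]
  exact (one_lt_inv₀ h.1).2 h.2 |>.le

theorem mul_cfErr_lt (hα : α ∈ Ioo (0 : ℝ) 1) (hirr : Irrational α) {k s : ℕ}
    (hs : s ≤ cfa α (k + 1)) : s * cfErr α (k + 1) < cfErr α k := by
  have h1 := cfErr_pos hα hirr (k + 2)
  rw [cfErr_add_two] at h1
  have h2 : (s : ℝ) ≤ cfa α (k + 1) := by exact_mod_cast hs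
  nlinarith [cfErr_pos hα hirr (k + 1)]

theorem cfDelta_eq (hα : α ∈ Ioo (0 : ℝ) 1) (hirr : Irrational α) {k s : ℕ}
    (hs : s ≤ cfa α (k + 1)) : cfDelta α k s = cfErr α k - ((s : ℝ) - 1) * cfErr α (k + 1) := by
  have h : cfDelta α k s = |cfErr α k - ((s : ℝ) - 1) * cfErr α (k + 1)| := by
    have hsign : |(-1 : ℝ) ^ k| = 1 := by simp
    rw [cfDelta, ← one_mul (|_|), ← hsign, ← abs_mul]
    simp only [cfErr]
    congr 1
    ring
  rw [h, abs_of_pos]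
  linarith [mul_cfErr_lt hα hirr hs, cfErr_pos hα hirr (k + 1)]

theorem cfSum_succ (k : ℕ) : cfSum α (k + 1) = cfSum α k + cfa α (k + 1) :=
  Finset.sum_range_succ _ _

/-- The gaps of `F` are `x` and `y`, on the sides prescribed by the parity of `k`. -/
def FareyPair.HasGaps (α : ℝ) (F : FareyPair) (k : ℕ) (x y : ℝ) : Prop :=
  Even k ∧ F.lowGap α = x ∧ F.highGap α = y ∨ ¬ Even k ∧ F.highGap α = x ∧ F.lowGap α = y

theorem FareyPair.HasGaps.next_of_lt {F : FareyPair} {k : ℕ} {x y : ℝ} (h : F.HasGaps α k x y)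
    (hxy : x < y) : (F.next α).HasGaps α k x (y - x) := by
  rcases h with ⟨hk, rfl, rfl⟩ | ⟨hk, rfl, rfl⟩
  · exact Or.inl ⟨hk, lowGap_next_of_lt hxy, highGap_next_of_lt hxy⟩
  · exact Or.inr ⟨hk, highGap_next_of_not_lt hxy.not_gt, lowGap_next_of_not_lt hxy.not_gt⟩

theorem FareyPair.HasGaps.symm {F : FareyPair} {k : ℕ} {x y : ℝ} (h : F.HasGaps α k x y) :
    F.HasGaps α (k + 1) y x := by
  rcases h with ⟨hk, h1, h2⟩ | ⟨hk, h1, h2⟩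
  · exact Or.inr ⟨by simpa [Nat.even_add_one] using hk, h2, h1⟩
  · exact Or.inl ⟨by simpa [Nat.even_add_one] using hk, h2, h1⟩

theorem hasGaps_fareyPair_add (hα : α ∈ Ioo (0 : ℝ) 1) (hirr : Irrational α) {k : ℕ}
    (h : (fareyPair α (cfSum α k)).HasGaps α k (cfErr α (k + 1)) (cfErr α k - cfErr α (k + 1)))
    {s : ℕ} (hs : s < cfa α (k + 1)) :
    (fareyPair α (cfSum α k + s)).HasGaps α k (cfErr α (k + 1))
      (cfErr α k - (s + 1) * cfErr α (k + 1)) := by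
  induction s with
  | zero => simpa using h
  | succ s ih =>
    have hlt := mul_cfErr_lt hα hirr (k := k) (s := s + 2) (by omega)
    push_cast at hlt
    have h' := (ih (by omega)).next_of_lt (by linarith)
    rwa [sub_sub, ← add_one_mul, ← Nat.cast_add_one] at h'

theorem hasGaps_fareyPair_cfSum (hα : α ∈ Ioo (0 : ℝ) 1) (hirr : Irrational α) (k : ℕ) :
    (fareyPair α (cfSum α k)).HasGaps α k (cfErr α (k + 1)) (cfErr α k - cfErr α (k + 1)) := by
  induction k with
  | zero => exact Or.inl ⟨by simp, by simp [fareyPair, lowGap, cfSum, cfErr_one],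
      by simp [fareyPair, highGap, cfSum, cfErr_one, cfErr_zero]⟩
  | succ k ih =>
    have h1 := one_le_cfa hα hirr k
    have h := hasGaps_fareyPair_add hα hirr ih (s := cfa α (k + 1) - 1) (by omega)
    have hs : cfErr α k - (((cfa α (k + 1) - 1 : ℕ) : ℝ) + 1) * cfErr α (k + 1) =
        cfErr α (k + 2) := by
      rw [cfErr_add_two, Nat.cast_sub h1]
      push_cast
      ring
    rw [hs] at h
    have hn : cfSum α (k + 1) = cfSum α k + (cfa α (k + 1) - 1) + 1 := by
      rw [cfSum_succ]
      omega
    rw [hn]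
    exact h.symm.next_of_lt (cfErr_succ_lt hα hirr (k + 1))

theorem gap_sum_fareyPair_eq_cfDelta (hα : α ∈ Ioo (0 : ℝ) 1) (hirr : Irrational α) {k s : ℕ}
    (hs : s < cfa α (k + 1)) :
    (fareyPair α (cfSum α k + s)).highGap α + (fareyPair α (cfSum α k + s)).lowGap α =
      cfDelta α k (s + 1) := by
  rw [cfDelta_eq hα hirr hs]
  push_cast
  rcases hasGaps_fareyPair_add hα hirr (hasGaps_fareyPair_cfSum hα hirr k) hs with
    ⟨-, h1, h2⟩ | ⟨-, h1, h2⟩ <;> rw [h1, h2] <;> ring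

theorem lt_gap_sum_of_lex_minimal (hα : α ∈ Ioo (0 : ℝ) 1) (hirr : Irrational α) {t : ℝ} {k s : ℕ}
    (hs : s < cfa α (k + 1))
    (hmin : ∀ k' s' : ℕ, 1 ≤ s' → s' ≤ cfa α (k' + 1) → cfDelta α k' s' ≤ t →
      k < k' ∨ (k = k' ∧ s + 1 ≤ s')) {n : ℕ} (hn : n + 1 = cfSum α k + s) :
    t < (fareyPair α n).highGap α + (fareyPair α n).lowGap α := by
  obtain ⟨k', s', hs', hk', rfl⟩ : ∃ k' s', s' < cfa α (k' + 1) ∧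
      (k' < k ∨ k' = k ∧ s' < s) ∧ n = cfSum α k' + s' := by
    rcases Nat.eq_zero_or_pos s with rfl | hs0
    · rcases k with _ | k
      · simp [cfSum] at hn
      · have h1 := one_le_cfa hα hirr k
        rw [cfSum_succ] at hn
        exact ⟨k, cfa α (k + 1) - 1, by omega, by omega, by omega⟩
    · exact ⟨k, s - 1, by omega, by omega, by omega⟩
  rw [gap_sum_fareyPair_eq_cfDelta hα hirr hs', ← not_le]
  intro h
  have := hmin k' (s' + 1) (by omega) (by omega) h
  omega

end ContinuedFraction

/-- if `a₁ ≥ 2`, `ρ ∉ (α, 1-α)` and `(k,s)` is the lexicographically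
minimal pair with `1 ≤ s ≤ a_{k+1}` and `min{ρ,1-ρ} ≥ δ_{k,s}`, then
`#APR_u = 2 + a₁ + ⋯ + a_k + s`. -/
theorem card_APR_outside (α ρ : ℝ) (hα : α ∈ Set.Ioo (0:ℝ) 1)
    (hirr : Irrational α) (hρ : ρ ∈ Set.Ioo (0:ℝ) 1)
    (ha1 : 2 ≤ cfa α 1) (hρint : ρ ∉ Set.Ioo α (1 - α))
    (k s : ℕ) (hs1 : 1 ≤ s) (hs2 : s ≤ cfa α (k + 1))
    (hρδ : cfDelta α k s ≤ min ρ (1 - ρ))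
    (hmin : ∀ k' s' : ℕ, 1 ≤ s' → s' ≤ cfa α (k' + 1) →
      cfDelta α k' s' ≤ min ρ (1 - ρ) → k < k' ∨ (k = k' ∧ s ≤ s')) :
    (APR (sturmian α ρ)).ncard = 2 + (∑ i ∈ Finset.range k, cfa α (i + 1)) + s := by
  have hlt : α < 1 / 2 := by
    have h2 : ((2 : ℕ) : ℝ) * cfErr α 1 < cfErr α 0 := mul_cfErr_lt hα hirr ha1
    rw [cfErr_zero, cfErr_one] at h2
    push_cast at h2
    linarith
  obtain ⟨s, rfl⟩ := Nat.exists_eq_add_of_le' hs1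
  have hle : (fareyPair α (cfSum α k + s)).highGap α + (fareyPair α (cfSum α k + s)).lowGap α ≤
      min ρ (1 - ρ) := by
    rwa [gap_sum_fareyPair_eq_cfDelta hα hirr hs2]
  have hgt := fun n => lt_gap_sum_of_lex_minimal hα hirr hs2 hmin (n := n)
  have h0 : (fareyPair α 0).highGap α + (fareyPair α 0).lowGap α = 1 := by
    simp [fareyPair, FareyPair.highGap, FareyPair.lowGap]
  have h1 : (fareyPair α 1).highGap α + (fareyPair α 1).lowGap α = 1 - α := by
    have := gap_sum_fareyPair_eq_cfDelta hα hirr (k := 0) (s := 1) ha1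
    rw [cfDelta_eq hα hirr (by simpa using ha1), cfErr_zero, cfErr_one] at this
    norm_num [cfSum] at this
    exact this
  obtain ⟨hρ0, hρ1⟩ := hρ
  have hρint' : ρ ≤ α ∨ 1 - α ≤ ρ := by
    by_contra! h
    exact hρint h
  rcases le_total ρ (1 - ρ) with h | h
  · rw [min_eq_left h] at hle hgt
    rw [ncard_APR_sturmian_eq_add hα hirr ⟨hρ0, hρ1⟩ hle hgt (N := 1)
      (by rw [h1]; rcases hρint' with h | h <;> linarith)
      (fun n hn => by obtain rfl : n = 0 := by omega
                      rw [h0]; linarith), cfSum]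
    omega
  · rw [min_eq_right h] at hle hgt
    rw [ncard_APR_sturmian_eq_add hα hirr ⟨hρ0, hρ1⟩ (M := 1)
      (by rw [h1]; rcases hρint' with h | h <;> linarith)
      (fun n hn => by obtain rfl : n = 0 := by omega
                      rw [h0]; linarith) hle hgt, cfSum]
    omega
end

section
/- Let α ∈ (0,1) be irrational, let β satisfy α ≤ β ≤ 1, and let l be the (unique) nonnegative integer with 1 − (l+1)α < β ≤ 1 − lα. Set I = [0,β). Then: for every x ∈ [0, β + (l+1)α − 1), the return time is r_I(x) = l+1 and the I-itinerary is R_I(x) = 01^l; for every x ∈ [β + (l+1)α − 1, α), r_I(x) = l+2 and R_I(x) = 01^{l+1}; and for every x ∈ [α, β), r_I(x) = 1 and R_I(x) = 1. (Here 01^l denotes the letter 0 followed by l letters 1.) -/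
open Set

theorem twoIE_iterate_succ_of_le {α x : ℝ} (hα : 0 ≤ α) (hx : x < α) {n : ℕ}
    (hn : α ≤ x + 1 - n * α) {k : ℕ} (hk : k ≤ n) :
    (twoIE α)^[k + 1] x = x + 1 - ((k : ℝ) + 1) * α := by
  induction k with
  | zero => simp [twoIE, hx]
  | succ k ih =>
    have hkn : ((k : ℝ) + 1) * α ≤ n * α :=
      mul_le_mul_of_nonneg_right (by exact_mod_cast hk) hα
    rw [Function.iterate_succ_apply', ih (by omega), twoIE, if_neg (by linarith)]
    push_cast
    ring

theorem returnTime_eq_of_forall_notMem {α x : ℝ} {I : Set ℝ} {n : ℕ}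
    (hmem : (twoIE α)^[n + 1] x ∈ I) (hnot : ∀ k < n, (twoIE α)^[k + 1] x ∉ I) :
    returnTime α I x = n + 1 := by
  refine IsLeast.csInf_eq ⟨⟨n.succ_pos, hmem⟩, ?_⟩
  rintro m ⟨hm, hmI⟩
  obtain ⟨k, rfl⟩ := Nat.exists_eq_add_one_of_ne_zero hm.ne'
  by_contra hlt
  exact hnot k (by omega) hmI

theorem wordPrefix_succ_eq_cons_replicate {u : ℕ → Bool} {b c : Bool} {n : ℕ} (h0 : u 0 = b)
    (hu : ∀ k < n, u (k + 1) = c) : wordPrefix u (n + 1) = b :: List.replicate n c := by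
  simp only [wordPrefix, seg, List.range_succ_eq_map, List.map_cons, List.map_map, zero_add, h0]
  congr 1
  rw [List.eq_replicate_iff]
  refine ⟨by simp, ?_⟩
  simp only [List.mem_map, List.mem_range]
  rintro _ ⟨k, hk, rfl⟩
  exact hu k hk

/-- A point of `[0,α)` whose orbit descends by steps of `α` from `x + 1 - α` and enters `[0,β)`
at the `n`-th such step has return time `n + 1` and itinerary `01^n`. -/
theorem returnTime_itin_of_lt {α β x : ℝ} (hα : 0 ≤ α) (hβ : α ≤ β) (hx : x < α) {n : ℕ}
    (hn : β ≤ x + 1 - n * α) (hmem : x + 1 - ((n : ℝ) + 1) * α ∈ Ico 0 β) :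
    returnTime α (Ico 0 β) x = n + 1 ∧
      itin α (Ico 0 β) x = false :: List.replicate n true := by
  have horbit {k : ℕ} (hk : k ≤ n) := twoIE_iterate_succ_of_le hα hx (hβ.trans hn) hk
  have hlarge {k : ℕ} (hk : k < n) : β ≤ (twoIE α)^[k + 1] x := by
    rw [horbit hk.le]
    have : ((k : ℝ) + 1) * α ≤ n * α := mul_le_mul_of_nonneg_right (by exact_mod_cast hk) hα
    linarith
  have hret : returnTime α (Ico 0 β) x = n + 1 :=
    returnTime_eq_of_forall_notMem (by rwa [horbit le_rfl])
      fun k hk h ↦ (hlarge hk).not_gt h.2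
  refine ⟨hret, ?_⟩
  rw [itin, hret]
  refine wordPrefix_succ_eq_cons_replicate (if_neg hx.not_ge) fun k hk ↦ ?_
  exact if_pos (hβ.trans (hlarge hk))

/-- for `I = [0,β)` with `α ≤ β ≤ 1` and `l` the nonnegative integer
with `1-(l+1)α < β ≤ 1-lα`: on `[0, β+(l+1)α-1)` the return time is `l+1` with
itinerary `01^l`; on `[β+(l+1)α-1, α)` it is `l+2` with itinerary `01^{l+1}`;
and on `[α, β)` it is `1` with itinerary `1`. -/
theorem itineraries_of_interval_containing_alpha (α : ℝ)
    (hα : α ∈ Set.Ioo (0:ℝ) 1) (hirr : Irrational α)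
    (β : ℝ) (hβ1 : α ≤ β) (hβ2 : β ≤ 1) (l : ℕ)
    (hl1 : 1 - ((l : ℝ) + 1) * α < β) (hl2 : β ≤ 1 - (l : ℝ) * α) :
    (∀ x ∈ Set.Ico (0:ℝ) (β + ((l : ℝ) + 1) * α - 1),
      returnTime α (Set.Ico (0:ℝ) β) x = l + 1 ∧
        itin α (Set.Ico (0:ℝ) β) x = false :: List.replicate l true) ∧
    (∀ x ∈ Set.Ico (β + ((l : ℝ) + 1) * α - 1) α,
      returnTime α (Set.Ico (0:ℝ) β) x = l + 2 ∧
        itin α (Set.Ico (0:ℝ) β) x = false :: List.replicate (l + 1) true) ∧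
    (∀ x ∈ Set.Ico α β,
      returnTime α (Set.Ico (0:ℝ) β) x = 1 ∧
        itin α (Set.Ico (0:ℝ) β) x = [true]) := by
  have hα0 := hα.1
  refine ⟨fun x hx ↦ ?_, fun x hx ↦ ?_, fun x hx ↦ ?_⟩
  · obtain ⟨hx0, hxlt⟩ := hx
    exact returnTime_itin_of_lt hα0.le hβ1 (by linarith) (by linarith)
      ⟨by linarith, by linarith⟩
  · obtain ⟨hxge, hxα⟩ := hx
    exact returnTime_itin_of_lt hα0.le hβ1 hxα (by push_cast; linarith)
      ⟨by push_cast; linarith, by push_cast; linarith⟩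
  · obtain ⟨hxα, hxβ⟩ := hx
    have hret : returnTime α (Ico 0 β) x = 0 + 1 :=
      returnTime_eq_of_forall_notMem
        (by simpa [twoIE, hxα.not_gt] using ⟨hxα, by linarith⟩) (by simp)
    refine ⟨hret, ?_⟩
    rw [itin, hret]
    exact wordPrefix_succ_eq_cons_replicate (c := true) (if_pos hxα) (by simp)
end
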